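/- arXiv:2510.22861 — 3 statements merged into one kernel-verified Lean document; each statement's English description precedes it below -/
import Mathlib

section
/- Let λ₁,…,λₙ ∈ ℂ be pairwise distinct, μ₁,…,μₘ ∈ ℂ be pairwise distinct, α, β ∈ ℂ^{n×m}, and fix i ∈ {1,…,n}, j ∈ {1,…,m} with α_{ij} ≠ 0. Define R(x,y) = (Σ_{k=1}^n Σ_{l=1}^m β_{kl}/((x−λ_k)(y−μ_l))) / (Σ_{k=1}^n Σ_{l=1}^m α_{kl}/((x−λ_k)(y−μ_l))) on the set of points (x,y) with x ∉ {λ₁,…,λₙ}, y ∉ {μ₁,…,μₘ} and nonvanishing denominator. Then R(x,y) → β_{ij}/α_{ij} as (x,y) → (λ_i, μ_j) within this domain (the joint limit exists and equals β_{ij}/α_{ij}). -/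
open Filter Topology BigOperators

noncomputable section

/-- Numerator of the (original) bivariate barycentric form:
`Σₖₗ βₖₗ / ((x − λₖ)(y − μₗ))`. -/
def baryNum {n m : ℕ} (lam : Fin n → ℂ) (mu : Fin m → ℂ)
    (beta : Matrix (Fin n) (Fin m) ℂ) (x y : ℂ) : ℂ :=
  ∑ k, ∑ l, beta k l / ((x - lam k) * (y - mu l))

/-- Denominator of the (original) bivariate barycentric form:
`Σₖₗ αₖₗ / ((x − λₖ)(y − μₗ))`. -/
def baryDen {n m : ℕ} (lam : Fin n → ℂ) (mu : Fin m → ℂ)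
    (alpha : Matrix (Fin n) (Fin m) ℂ) (x y : ℂ) : ℂ :=
  ∑ k, ∑ l, alpha k l / ((x - lam k) * (y - mu l))

/-- Near the node `v i`, the quotient `(x - v i) / (x - v k)` tends to the Kronecker delta. -/
theorem tendsto_sub_div_sub_node {n : ℕ} {v : Fin n → ℂ} (hv : Function.Injective v)
    (i k : Fin n) :
    Tendsto (fun x : ℂ => (x - v i) / (x - v k)) (𝓝[(Set.range v)ᶜ] (v i))
      (𝓝 (if k = i then 1 else 0)) := by
  split_ifs with h
  · subst h
    refine tendsto_const_nhds.congr' ?_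
    filter_upwards [self_mem_nhdsWithin] with x hx
    exact (div_self (sub_ne_zero.2 fun e => hx ⟨k, e.symm⟩)).symm
  · have hne : v i - v k ≠ 0 := sub_ne_zero.2 fun e => h (hv e).symm
    have hc : ContinuousAt (fun x : ℂ => (x - v i) / (x - v k)) (v i) := by
      fun_prop (disch := exact hne)
    simpa using hc.tendsto.mono_left nhdsWithin_le_nhds

/-- Multiplying a double barycentric sum by `(x - λᵢ)(y - μⱼ)` isolates the coefficient `cᵢⱼ`
in the limit. -/
theorem tendsto_mul_baryNum {n m : ℕ} {lam : Fin n → ℂ} {mu : Fin m → ℂ}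
    (hlam : Function.Injective lam) (hmu : Function.Injective mu)
    (c : Matrix (Fin n) (Fin m) ℂ) (i : Fin n) (j : Fin m) :
    Tendsto (fun p : ℂ × ℂ => (p.1 - lam i) * (p.2 - mu j) * baryNum lam mu c p.1 p.2)
      (𝓝[(Set.range lam)ᶜ ×ˢ (Set.range mu)ᶜ] (lam i, mu j)) (𝓝 (c i j)) := by
  rw [nhdsWithin_prod_eq]
  have h : Tendsto (fun p : ℂ × ℂ => ∑ k, ∑ l,
      c k l * (((p.1 - lam i) / (p.1 - lam k)) * ((p.2 - mu j) / (p.2 - mu l))))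
      (𝓝[(Set.range lam)ᶜ] (lam i) ×ˢ 𝓝[(Set.range mu)ᶜ] (mu j))
      (𝓝 (∑ k, ∑ l, c k l * ((if k = i then 1 else 0) * (if l = j then 1 else 0)))) :=
    tendsto_finsetSum _ fun k _ => tendsto_finsetSum _ fun l _ =>
      (((tendsto_sub_div_sub_node hlam i k).comp tendsto_fst).mul
        ((tendsto_sub_div_sub_node hmu j l).comp tendsto_snd)).const_mul _
  convert h using 2 with p
  · simp only [baryNum, Finset.mul_sum]
    refine Finset.sum_congr rfl fun k _ => Finset.sum_congr rfl fun l _ => ?_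
    rw [div_mul_div_comm]
    ring
  · simp

/-- The barycentric form `R(x,y)` tends to `βᵢⱼ/αᵢⱼ` as `(x,y) → (λᵢ,μⱼ)` within the
domain of points whose coordinates avoid the nodes and where the denominator
does not vanish. -/
theorem barycentric_removable_singularity {n m : ℕ} (lam : Fin n → ℂ) (mu : Fin m → ℂ)
    (hlam : Function.Injective lam) (hmu : Function.Injective mu)
    (alpha beta : Matrix (Fin n) (Fin m) ℂ) (i : Fin n) (j : Fin m)
    (halpha : alpha i j ≠ 0) :
    Tendsto (fun p : ℂ × ℂ => baryNum lam mu beta p.1 p.2 / baryDen lam mu alpha p.1 p.2)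
      (𝓝[{p : ℂ × ℂ | p.1 ∉ Set.range lam ∧ p.2 ∉ Set.range mu ∧
          baryDen lam mu alpha p.1 p.2 ≠ 0}] (lam i, mu j))
      (𝓝 (beta i j / alpha i j)) := by
  have hle : 𝓝[{p : ℂ × ℂ | p.1 ∉ Set.range lam ∧ p.2 ∉ Set.range mu ∧
      baryDen lam mu alpha p.1 p.2 ≠ 0}] (lam i, mu j) ≤
      𝓝[(Set.range lam)ᶜ ×ˢ (Set.range mu)ᶜ] (lam i, mu j) :=
    nhdsWithin_mono _ fun p hp => ⟨hp.1, hp.2.1⟩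
  refine (((tendsto_mul_baryNum hlam hmu beta i j).div
    (tendsto_mul_baryNum hlam hmu alpha i j) halpha).mono_left hle).congr' ?_
  filter_upwards [self_mem_nhdsWithin] with p hp
  have hx : p.1 - lam i ≠ 0 := sub_ne_zero.2 fun e => hp.1 ⟨i, e.symm⟩
  have hy : p.2 - mu j ≠ 0 := sub_ne_zero.2 fun e => hp.2.1 ⟨j, e.symm⟩
  exact mul_div_mul_left _ _ (mul_ne_zero hx hy)
end
end

section
/- Let (Λ₁,M₁),…,(Λ_K,M_K) ∈ ℂ² with Λ₁,…,Λ_K pairwise distinct and M₁,…,M_K pairwise distinct, let f₁,…,f_K ∈ ℂ, and let α̂₁,…,α̂_K ∈ ℂ with α̂_i ≠ 0. Define the sparse barycentric form r̂(x,y) = (Σ_{i=1}^K α̂_i f_i/((x−Λ_i)(y−M_i))) / (Σ_{i=1}^K α̂_i/((x−Λ_i)(y−M_i))). Then for every fixed i ∈ {1,…,K} and every fixed y ∈ ℂ with y ∉ {M₁,…,M_K}, the one-variable limit holds: r̂(x,y) → f_i as x → Λ_i with x ∉ {Λ₁,…,Λ_K} (along points where the denominator is nonzero). -/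
open Filter Topology BigOperators

noncomputable section

/-- Numerator of the sparse bivariate barycentric form: `Σᵢ α̂ᵢ fᵢ / ((x−Λᵢ)(y−Mᵢ))`. -/
def sparseNum {K : ℕ} (Lam Mm : Fin K → ℂ) (f ahat : Fin K → ℂ) (x y : ℂ) : ℂ :=
  ∑ i, ahat i * f i / ((x - Lam i) * (y - Mm i))

/-- Denominator of the sparse bivariate barycentric form: `Σᵢ α̂ᵢ / ((x−Λᵢ)(y−Mᵢ))`. -/
def sparseDen {K : ℕ} (Lam Mm : Fin K → ℂ) (ahat : Fin K → ℂ) (x y : ℂ) : ℂ :=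
  ∑ i, ahat i / ((x - Lam i) * (y - Mm i))

/-- Multiplying by `x - Λᵢ` isolates the residue of `Σⱼ cⱼ / ((x - Λⱼ)(y - Mⱼ))` at the simple
pole `x = Λᵢ`. -/
theorem tendsto_sub_mul_sum_div {K : ℕ} {Lam : Fin K → ℂ} (hLam : Function.Injective Lam)
    (Mm c : Fin K → ℂ) (i : Fin K) (y : ℂ) :
    Tendsto (fun x => (x - Lam i) * ∑ j, c j / ((x - Lam j) * (y - Mm j)))
      (𝓝[≠] (Lam i)) (𝓝 (c i / (y - Mm i))) := by
  have hsum : c i / (y - Mm i) = ∑ j, if j = i then c j / (y - Mm j) else 0 := by simp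
  simp_rw [Finset.mul_sum]
  rw [hsum]
  refine tendsto_finsetSum _ fun j _ => ?_
  by_cases hji : j = i
  · subst hji
    rw [if_pos rfl]
    refine tendsto_const_nhds.congr' ?_
    filter_upwards [self_mem_nhdsWithin] with x hx
    rw [mul_div_assoc', mul_div_mul_left _ _ (sub_ne_zero.mpr hx)]
  · rw [if_neg hji]
    have hne : Lam i - Lam j ≠ 0 := sub_ne_zero.mpr fun h => hji (hLam h).symm
    have hcont : ContinuousAt
        (fun x => (x - Lam i) * (c j / (x - Lam j) / (y - Mm j))) (Lam i) := by
      fun_prop (disch := exact hne)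
    have hlim := hcont.tendsto.mono_left (nhdsWithin_le_nhds (s := {Lam i}ᶜ))
    simpa [div_div] using hlim

/-- For fixed `y` avoiding the nodes `M₁,…,M_K`, the sparse barycentric form `r̂(x,y)`
tends to `fᵢ` as `x → Λᵢ` along points avoiding the nodes `Λ₁,…,Λ_K` where the
denominator does not vanish. -/
theorem sparse_barycentric_one_variable_limit {K : ℕ} (Lam Mm : Fin K → ℂ)
    (hLam : Function.Injective Lam) (hMm : Function.Injective Mm)
    (f ahat : Fin K → ℂ) (hahat : ∀ i, ahat i ≠ 0)
    (i : Fin K) (y : ℂ) (hy : y ∉ Set.range Mm) :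
    Tendsto (fun x => sparseNum Lam Mm f ahat x y / sparseDen Lam Mm ahat x y)
      (𝓝[{x : ℂ | x ∉ Set.range Lam ∧ sparseDen Lam Mm ahat x y ≠ 0}] (Lam i))
      (𝓝 (f i)) := by
  have hyi : y - Mm i ≠ 0 := sub_ne_zero.mpr fun h => hy ⟨i, h.symm⟩
  have hsub : {x : ℂ | x ∉ Set.range Lam ∧ sparseDen Lam Mm ahat x y ≠ 0} ⊆ {Lam i}ᶜ := by
    rintro x ⟨hx, -⟩ rfl
    exact hx ⟨i, rfl⟩
  have hlim := (tendsto_sub_mul_sum_div hLam Mm (fun j => ahat j * f j) i y).div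
    (tendsto_sub_mul_sum_div hLam Mm ahat i y) (div_ne_zero (hahat i) hyi)
  rw [div_div_div_cancel_right₀ hyi, mul_div_cancel_left₀ _ (hahat i)] at hlim
  refine (hlim.mono_left (nhdsWithin_mono _ hsub)).congr' ?_
  filter_upwards [self_mem_nhdsWithin] with x hx
  exact mul_div_mul_left _ _ (sub_ne_zero.mpr (hsub hx))
end
end

section
/- Let (Λ₁,M₁),…,(Λ_K,M_K) ∈ ℂ² with Λ₁,…,Λ_K pairwise distinct and M₁,…,M_K pairwise distinct, let f₁,…,f_K ∈ ℂ, and let α̂₁,…,α̂_K ∈ ℂ with all α̂_i ≠ 0, and let r̂ be the sparse barycentric form built from this data. Fix i ≠ j with f_i ≠ f_j. Then the two iterated limits at the point (Λ_i, M_j) exist and disagree: lim_{y→M_j} ( lim_{x→Λ_i} r̂(x,y) ) = f_i while lim_{x→Λ_i} ( lim_{y→M_j} r̂(x,y) ) = f_j, where inner limits are taken over x ∉ {Λ₁,…,Λ_K} and y ∉ {M₁,…,M_K} respectively. In particular, r̂ has a non-removable singularity at (Λ_i, M_j): there is no value c ∈ ℂ such that r̂(x,y) → c as (x,y) → (Λ_i,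 M_j) within the domain of r̂. -/
open Filter Topology BigOperators

noncomputable section

/-- The sparse barycentric form `r̂`. -/
def sparseR {K : ℕ} (Lam Mm : Fin K → ℂ) (f ahat : Fin K → ℂ) (x y : ℂ) : ℂ :=
  sparseNum Lam Mm f ahat x y / sparseDen Lam Mm ahat x y

/-- A finite set misses a punctured neighbourhood of every point. -/
theorem Set.Finite.eventually_notMem_nhdsNE {X : Type*} [TopologicalSpace X] [T1Space X]
    {s : Set X} (hs : s.Finite) (a : X) : ∀ᶠ x in 𝓝[≠] a, x ∉ s := by
  have h : (s \ {a})ᶜ ∈ 𝓝 a := (hs.subset Set.sdiff_subset).isClosed.isOpen_compl.mem_nhds (by simp)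
  filter_upwards [mem_nhdsWithin_of_mem_nhds h, self_mem_nhdsWithin] with x hx hxa hxs
  exact hx ⟨hxs, hxa⟩

/-- A sum of simple poles at distinct nodes has residue `w i` at the node `z i`. -/
theorem tendsto_sub_mul_sum_div_sub {ι : Type*} [Fintype ι] {z : ι → ℂ}
    (hz : Function.Injective z) (w : ι → ℂ) (i : ι) :
    Tendsto (fun x => (x - z i) * ∑ k, w k / (x - z k)) (𝓝[≠] z i) (𝓝 (w i)) := by
  classical
  have h : ∀ k, Tendsto (fun x => (x - z i) * (w k / (x - z k))) (𝓝[≠] z i)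
      (𝓝 (if k = i then w i else 0)) := by
    intro k
    split_ifs with hk
    · subst hk
      refine tendsto_const_nhds.congr' ?_
      filter_upwards [self_mem_nhdsWithin] with x hx
      rw [mul_div_cancel₀ _ (sub_ne_zero.mpr hx)]
    · have hne : z i - z k ≠ 0 := sub_ne_zero.mpr fun e => hk (hz e).symm
      have hc : ContinuousAt (fun x => (x - z i) * (w k / (x - z k))) (z i) := by
        fun_prop (disch := exact hne)
      simpa using hc.tendsto.mono_left nhdsWithin_le_nhds
  simpa [Finset.mul_sum] using tendsto_finsetSum Finset.univ fun k _ => h k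

theorem sparseNum_eq_sum_div_sub {K : ℕ} (Lam Mm f ahat : Fin K → ℂ) (x y : ℂ) :
    sparseNum Lam Mm f ahat x y = ∑ k, ahat k * f k / (y - Mm k) / (x - Lam k) := by
  simp only [sparseNum, div_div, mul_comm]

theorem sparseDen_eq_sum_div_sub {K : ℕ} (Lam Mm ahat : Fin K → ℂ) (x y : ℂ) :
    sparseDen Lam Mm ahat x y = ∑ k, ahat k / (y - Mm k) / (x - Lam k) := by
  simp only [sparseDen, div_div, mul_comm]

theorem sparseDen_swap {K : ℕ} (Lam Mm ahat : Fin K → ℂ) (x y : ℂ) :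
    sparseDen Mm Lam ahat y x = sparseDen Lam Mm ahat x y := by
  simp only [sparseDen, mul_comm]

theorem sparseR_swap {K : ℕ} (Lam Mm f ahat : Fin K → ℂ) (x y : ℂ) :
    sparseR Mm Lam f ahat y x = sparseR Lam Mm f ahat x y := by
  simp only [sparseR, sparseNum, sparseDen, mul_comm]

theorem div_sub_node_ne_zero {K : ℕ} {Mm ahat : Fin K → ℂ} (hahat : ∀ k, ahat k ≠ 0) {y : ℂ}
    (hy : y ∉ Set.range Mm) (i : Fin K) : ahat i / (y - Mm i) ≠ 0 :=
  div_ne_zero (hahat i) (sub_ne_zero.mpr fun e => hy ⟨i, e.symm⟩)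

theorem eventually_sparseDen_ne_zero {K : ℕ} {Lam Mm ahat : Fin K → ℂ}
    (hLam : Function.Injective Lam) (hahat : ∀ k, ahat k ≠ 0) (i : Fin K) {y : ℂ}
    (hy : y ∉ Set.range Mm) : ∀ᶠ x in 𝓝[≠] Lam i, sparseDen Lam Mm ahat x y ≠ 0 := by
  have h := (tendsto_sub_mul_sum_div_sub hLam (fun k => ahat k / (y - Mm k)) i).eventually_ne
    (div_sub_node_ne_zero hahat hy i)
  filter_upwards [h] with x hx
  rw [sparseDen_eq_sum_div_sub]
  exact right_ne_zero_of_mul hx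

theorem tendsto_sparseR_left {K : ℕ} {Lam Mm ahat : Fin K → ℂ}
    (hLam : Function.Injective Lam) (f : Fin K → ℂ) (hahat : ∀ k, ahat k ≠ 0) (i : Fin K) {y : ℂ}
    (hy : y ∉ Set.range Mm) :
    Tendsto (fun x => sparseR Lam Mm f ahat x y) (𝓝[≠] Lam i) (𝓝 (f i)) := by
  have hw := div_sub_node_ne_zero hahat hy i
  have h := (tendsto_sub_mul_sum_div_sub hLam (fun k => ahat k * f k / (y - Mm k)) i).div
    (tendsto_sub_mul_sum_div_sub hLam (fun k => ahat k / (y - Mm k)) i) hw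
  rw [mul_div_right_comm, mul_div_cancel_left₀ _ hw] at h
  refine h.congr' ?_
  filter_upwards [self_mem_nhdsWithin] with x hx
  rw [Pi.div_apply, mul_div_mul_left _ _ (sub_ne_zero.mpr hx), sparseR, sparseNum_eq_sum_div_sub,
    sparseDen_eq_sum_div_sub]

/-- A joint limit of `r̂` at a point of the line `x = Λᵢ` can only be `fᵢ`. -/
theorem eq_of_tendsto_sparseR {K : ℕ} {Lam Mm f ahat : Fin K → ℂ}
    (hLam : Function.Injective Lam) (hahat : ∀ k, ahat k ≠ 0) (i : Fin K) {b c : ℂ}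
    (hc : Tendsto (fun p : ℂ × ℂ => sparseR Lam Mm f ahat p.1 p.2)
      (𝓝[{p : ℂ × ℂ | p.1 ∉ Set.range Lam ∧ p.2 ∉ Set.range Mm ∧
        sparseDen Lam Mm ahat p.1 p.2 ≠ 0}] (Lam i, b)) (𝓝 c)) : c = f i := by
  have hb : ∀ᶠ y in 𝓝[≠] b, y ∉ Set.range Mm :=
    (Set.finite_range Mm).eventually_notMem_nhdsNE b
  have hdom : Tendsto Prod.swap ((𝓝[≠] b).curry (𝓝[≠] Lam i))
      (𝓝[{p : ℂ × ℂ | p.1 ∉ Set.range Lam ∧ p.2 ∉ Set.range Mm ∧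
        sparseDen Lam Mm ahat p.1 p.2 ≠ 0}] (Lam i, b)) := by
    refine tendsto_nhdsWithin_iff.mpr ⟨?_, ?_⟩
    · refine (continuous_swap.tendsto (b, Lam i)).mono_left (curry_le_prod.trans ?_)
      rw [nhds_prod_eq]
      exact prod_mono nhdsWithin_le_nhds nhdsWithin_le_nhds
    · refine eventually_curry_iff.mpr ?_
      filter_upwards [hb] with y hy
      filter_upwards [(Set.finite_range Lam).eventually_notMem_nhdsNE (Lam i),
        eventually_sparseDen_ne_zero hLam hahat i hy] with x hx hden
      exact ⟨hx, hy, hden⟩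
  have hlim : Tendsto (fun q : ℂ × ℂ => sparseR Lam Mm f ahat q.2 q.1)
      ((𝓝[≠] b).curry (𝓝[≠] Lam i)) (𝓝 (f i)) := by
    intro V hV
    refine mem_map.mpr (mem_curry_iff.mpr ?_)
    filter_upwards [hb] with y hy
    exact tendsto_sparseR_left hLam f hahat i hy hV
  have : ((𝓝[≠] b).curry (𝓝[≠] Lam i)).NeBot := by
    refine ⟨fun h => ?_⟩
    have hF : ∀ᶠ _ in (𝓝[≠] b).curry (𝓝[≠] Lam i), False := by simp [h]
    rw [eventually_curry_iff] at hF
    exact NeBot.ne inferInstance (by simpa using hF : 𝓝[≠] Lam i = ⊥)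
  exact tendsto_nhds_unique (hc.comp hdom) hlim

/-- For `i ≠ j` with `fᵢ ≠ fⱼ`, the two iterated limits of the sparse barycentric form
at `(Λᵢ, Mⱼ)` exist and disagree: the `x`-then-`y` iterated limit is `fᵢ` while the
`y`-then-`x` iterated limit is `fⱼ`; in particular `r̂` has a non-removable singularity
at `(Λᵢ, Mⱼ)`: no joint limit exists within the domain of `r̂`. -/
theorem sparse_barycentric_nonremovable_singularity {K : ℕ} (Lam Mm : Fin K → ℂ)
    (hLam : Function.Injective Lam) (hMm : Function.Injective Mm)
    (f ahat : Fin K → ℂ) (hahat : ∀ i, ahat i ≠ 0)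
    (i j : Fin K) (hij : i ≠ j) (hf : f i ≠ f j) :
    (∃ L : ℂ → ℂ,
      (∀ y ∉ Set.range Mm,
        Tendsto (fun x => sparseR Lam Mm f ahat x y)
          (𝓝[{x : ℂ | x ∉ Set.range Lam ∧ sparseDen Lam Mm ahat x y ≠ 0}] (Lam i))
          (𝓝 (L y))) ∧
      Tendsto L (𝓝[{y : ℂ | y ∉ Set.range Mm}] (Mm j)) (𝓝 (f i))) ∧
    (∃ L' : ℂ → ℂ,
      (∀ x ∉ Set.range Lam,
        Tendsto (fun y => sparseR Lam Mm f ahat x y)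
          (𝓝[{y : ℂ | y ∉ Set.range Mm ∧ sparseDen Lam Mm ahat x y ≠ 0}] (Mm j))
          (𝓝 (L' x))) ∧
      Tendsto L' (𝓝[{x : ℂ | x ∉ Set.range Lam}] (Lam i)) (𝓝 (f j))) ∧
    ¬ ∃ cval : ℂ,
      Tendsto (fun p : ℂ × ℂ => sparseR Lam Mm f ahat p.1 p.2)
        (𝓝[{p : ℂ × ℂ | p.1 ∉ Set.range Lam ∧ p.2 ∉ Set.range Mm ∧
            sparseDen Lam Mm ahat p.1 p.2 ≠ 0}] (Lam i, Mm j))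
        (𝓝 cval) := by
  have hx : 𝓝[{x : ℂ | x ∉ Set.range Lam}] (Lam i) ≤ 𝓝[≠] Lam i :=
    nhdsWithin_mono _ fun x hx e => hx ⟨i, e.symm⟩
  have hy : 𝓝[{y : ℂ | y ∉ Set.range Mm}] (Mm j) ≤ 𝓝[≠] Mm j :=
    nhdsWithin_mono _ fun y hy e => hy ⟨j, e.symm⟩
  refine ⟨⟨fun _ => f i, fun y hyM => ?_, tendsto_const_nhds⟩,
    ⟨fun _ => f j, fun x hxL => ?_, tendsto_const_nhds⟩, ?_⟩
  · exact (tendsto_sparseR_left hLam f hahat i hyM).mono_left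
      ((nhdsWithin_mono _ (Set.sep_subset _ _)).trans hx)
  · simp only [← sparseR_swap Lam Mm]
    exact (tendsto_sparseR_left hMm f hahat j hxL).mono_left
      ((nhdsWithin_mono _ (Set.sep_subset _ _)).trans hy)
  · rintro ⟨c, hc⟩
    have hswap : Tendsto Prod.swap
        (𝓝[{p : ℂ × ℂ | p.1 ∉ Set.range Mm ∧ p.2 ∉ Set.range Lam ∧
          sparseDen Mm Lam ahat p.1 p.2 ≠ 0}] (Mm j, Lam i))
        (𝓝[{p : ℂ × ℂ | p.1 ∉ Set.range Lam ∧ p.2 ∉ Set.range Mm ∧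
          sparseDen Lam Mm ahat p.1 p.2 ≠ 0}] (Lam i, Mm j)) := by
      refine continuous_swap.continuousWithinAt.tendsto_nhdsWithin ?_
      rintro ⟨y, x⟩ ⟨hyM, hxL, hden⟩
      exact ⟨hxL, hyM, by rwa [sparseDen_swap] at hden⟩
    have hcj : c = f j := eq_of_tendsto_sparseR hMm hahat j
      ((hc.comp hswap).congr fun p => (sparseR_swap Lam Mm f ahat p.2 p.1).symm)
    exact hf ((eq_of_tendsto_sparseR hLam hahat i hc).symm.trans hcj)
end
end
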